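/- Let K₀ be a nonzero real constant and I, J ⊆ ℝ open intervals. There do not exist smooth functions f : I → ℝ and g : J → ℝ with f affine and nonconstant (f'(x) = f₀ ≠ 0 for all x) and g nonconstant, such that f(x)g(y)f''(x)g''(y) − (f'(x)g'(y))² = K₀·(1 − (f(x)g'(y))²)² holds for all (x,y) ∈ I×J with 1 − (f(x)g'(y))² ≠ 0. Equivalently, the identity K₀ + (f₀² − 2K₀f(x)²)(g'(y))² + K₀f(x)⁴(g'(y))⁴ = 0 for all (x,y) is impossible. -/

import Mathlib

/-- A real function with constant derivative on an open interval is affine there. -/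
theorem exists_eq_affine_of_deriv_eq_const {s : Set ℝ} (hso : IsOpen s) (hsc : s.OrdConnected)
    {f : ℝ → ℝ} (hf : DifferentiableOn ℝ f s) {a : ℝ} (ha : ∀ x ∈ s, deriv f x = a) :
    ∃ c : ℝ, ∀ x ∈ s, f x = a * x + c := by
  have hlin : ∀ x, HasDerivAt (fun x : ℝ => a * x) a x := fun x => by
    simpa using (hasDerivAt_id x).const_mul a
  have hdiff : ∀ x ∈ s, HasDerivAt (fun x => f x - a * x) 0 x := fun x hx => by
    have hfx := (hf.differentiableAt (hso.mem_nhds hx)).hasDerivAt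
    rw [ha x hx] at hfx
    exact (sub_self a) ▸ hfx.fun_sub (hlin x)
  obtain ⟨c, hc⟩ := hso.exists_is_const_of_deriv_eq_zero hsc.isPreconnected
    (fun x hx => (hdiff x hx).differentiableAt.differentiableWithinAt)
    (fun x hx => (hdiff x hx).deriv)
  exact ⟨c, fun x hx => by linarith [hc x hx]⟩

open Polynomial in
/-- Every infinite set has a point `x` with `((a x + c) p)² ≠ 1` at which the relation
`-(a p)² = k (1 - ((a x + c) p)²)²` fails. -/
theorem exists_mem_ne_of_infinite {s : Set ℝ} (hs : s.Infinite) {a p : ℝ} (ha : a ≠ 0)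
    (hp : p ≠ 0) (c k : ℝ) :
    ∃ x ∈ s, 1 - ((a * x + c) * p) ^ 2 ≠ 0 ∧
      -(a * p) ^ 2 ≠ k * (1 - ((a * x + c) * p) ^ 2) ^ 2 := by
  by_contra! h
  let B : ℝ[X] := 1 - ((C a * X + C c) * C p) ^ 2
  let A : ℝ[X] := C ((a * p) ^ 2) + C k * B ^ 2
  have hBe : ∀ x, B.eval x = 1 - ((a * x + c) * p) ^ 2 := fun x => by simp [B]
  have hAe : ∀ x, A.eval x = (a * p) ^ 2 + k * (1 - ((a * x + c) * p) ^ 2) ^ 2 := fun x => by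
    simp [A, hBe]
  have hB : B ≠ 0 := fun h0 => by
    have h1 := hBe (-c / a)
    rw [h0, mul_div_cancel₀ _ ha] at h1
    simp at h1
  have hA : A ≠ 0 := fun h0 => by
    have h1 := hAe ((p⁻¹ - c) / a)
    rw [h0, mul_div_cancel₀ _ ha, sub_add_cancel, inv_mul_cancel₀ hp] at h1
    simp only [eval_zero, sub_self, one_pow, zero_pow two_ne_zero, mul_zero, add_zero] at h1
    exact pow_ne_zero 2 (mul_ne_zero ha hp) h1.symm
  refine mul_ne_zero hA hB (eq_zero_of_infinite_isRoot _ (hs.mono fun x hx => ?_))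
  change (A * B).eval x = 0
  rw [eval_mul, hAe, hBe]
  by_cases hx0 : 1 - ((a * x + c) * p) ^ 2 = 0
  · rw [hx0, mul_zero]
  · rw [← h x hx hx0, add_neg_cancel, zero_mul]

/-- Case a: there is no factorable surface of first kind `z(x,y) = f(x) g(y)` with
`f` affine nonconstant, `g` nonconstant, and nonzero constant Gaussian curvature `K₀`. -/
theorem no_factorable_first_kind_f_affine_constant_gauss_curvature
    (K₀ : ℝ) (hK₀ : K₀ ≠ 0)
    (I J : Set ℝ) (hIo : IsOpen I) (hIc : I.OrdConnected) (hIn : I.Nonempty)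
    (hJo : IsOpen J) (hJc : J.OrdConnected) (hJn : J.Nonempty)
    (f g : ℝ → ℝ) (hf : ContDiffOn ℝ (⊤ : ℕ∞) f I) (hg : ContDiffOn ℝ (⊤ : ℕ∞) g J)
    (f₀ : ℝ) (hf₀ : f₀ ≠ 0) (haff : ∀ x ∈ I, deriv f x = f₀)
    (hgnc : ¬ ∃ c : ℝ, ∀ y ∈ J, g y = c)
    (heq : ∀ x ∈ I, ∀ y ∈ J, 1 - (f x * deriv g y) ^ 2 ≠ 0 →
      f x * g y * deriv (deriv f) x * deriv (deriv g) y - (deriv f x * deriv g y) ^ 2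
        = K₀ * (1 - (f x * deriv g y) ^ 2) ^ 2) :
    False := by
  obtain ⟨y, hy, hp⟩ : ∃ y ∈ J, deriv g y ≠ 0 := by
    by_contra! h
    exact hgnc (hJo.exists_is_const_of_deriv_eq_zero hJc.isPreconnected
      (hg.differentiableOn (by simp)) h)
  obtain ⟨c, hc⟩ := exists_eq_affine_of_deriv_eq_const hIo hIc (hf.differentiableOn (by simp)) haff
  obtain ⟨x₀, hx₀⟩ := hIn
  obtain ⟨x, hx, hne, hrel⟩ := exists_mem_ne_of_infinite
    (infinite_of_mem_nhds x₀ (hIo.mem_nhds hx₀)) hf₀ hp c K₀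
  have hf'' : deriv (deriv f) x = 0 := by
    have hloc : deriv f =ᶠ[nhds x] fun _ => f₀ := Filter.eventually_of_mem (hIo.mem_nhds hx) haff
    rw [hloc.deriv_eq, deriv_const]
  rw [← hc x hx] at hne hrel
  have hK := heq x hx y hy hne
  rw [hf'', haff x hx] at hK
  exact hrel (by linarith)
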